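/- If n is even, every derivation φ ∈ Der(H_0̄, W_1̄) with φ(J) = 0 is zero. -/

import Mathlib

open Finsupp Finset

namespace HamSup

variable (F : Type) [Field F]

/-- Monomial index: a multi-exponent for the divided power part and a set of odd indices. -/
abbrev Mono (m n : ℕ) := (Fin m → ℕ) × Finset (Fin n)

/-- The superalgebra `O(m,n)` as the free module on monomials `x^(α) x^u`. -/
abbrev O (m n : ℕ) := Mono m n →₀ F

variable {m n : ℕ}

/-- The basis monomial `x^(α) x^u`. -/
noncomputable def X (μ : Mono m n) : O F m n := Finsupp.single μ 1

/-- Linear extension of a map defined on basis monomials. -/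
noncomputable def extend {N : Type} [AddCommGroup N] [Module F N]
    (v : Mono m n → N) : O F m n →ₗ[F] N :=
  Finsupp.lsum F fun μ => LinearMap.toSpanSingleton F N (v μ)

/-- Number of inversions when concatenating `x^u` and `x^v`. -/
def invCount (u v : Finset (Fin n)) : ℕ :=
  ((u ×ˢ v).filter fun q => q.2 < q.1).card

/-- Product of two basis monomials: divided-power binomial coefficients on the even part and
a sign (with nilpotency) on the exterior part. -/
noncomputable def mulMono (μ ν : Mono m n) : O F m n :=
  if Disjoint μ.2 ν.2 then
    (((-1 : F) ^ invCount μ.2 ν.2) * ∏ i, ((μ.1 i + ν.1 i).choose (μ.1 i) : F)) •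
      X F (μ.1 + ν.1, μ.2 ∪ ν.2)
  else 0

/-- The multiplication of `O(m,n)` as a bilinear map. -/
noncomputable def mulO : O F m n →ₗ[F] O F m n →ₗ[F] O F m n :=
  extend F fun μ => extend F (mulMono F μ)

/-- Even partial derivative `∂_i`, `i ∈ I₀`. -/
noncomputable def pdE (i : Fin m) : O F m n →ₗ[F] O F m n :=
  extend F fun μ =>
    if μ.1 i = 0 then 0 else X F (Function.update μ.1 i (μ.1 i - 1), μ.2)

/-- Odd partial derivative `∂_j`, `j ∈ I₁`. -/
noncomputable def pdO (j : Fin n) : O F m n →ₗ[F] O F m n :=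
  extend F fun μ =>
    if j ∈ μ.2 then ((-1 : F) ^ (μ.2.filter fun k => k < j).card) • X F (μ.1, μ.2.erase j)
    else 0

/-- Partial derivative indexed by `I = I₀ ⊔ I₁`. -/
noncomputable def pd (i : Fin m ⊕ Fin n) : O F m n →ₗ[F] O F m n :=
  Sum.elim (pdE F) (pdO F) i

/-- Parity `μ(i)` of an index. -/
def idxPar : Fin m ⊕ Fin n → ℕ := Sum.elim (fun _ => 0) (fun _ => 1)

/-- The sign `τ(i)`. -/
def tau (r : ℕ) : Fin m ⊕ Fin n → ℤ :=
  Sum.elim (fun i => if (i : ℕ) < r then 1 else -1) (fun _ => 1)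

/-- The basis vector field `x^(α) x^u ∂_i` of the Witt superalgebra, as an endomorphism. -/
noncomputable def fD (μ : Mono m n) (i : Fin m ⊕ Fin n) : Module.End F (O F m n) :=
  (mulO F (X F μ)).comp (pd F i)

/-- `D_H(x^(α)x^u) = Σ_i τ(i)(−1)^{μ(i)p(f)} ∂_i(f) ∂_{i'}` on a basis monomial. -/
noncomputable def DHmono (r : ℕ) (pr : Fin m ⊕ Fin n → Fin m ⊕ Fin n) (μ : Mono m n) :
    Module.End F (O F m n) :=
  ∑ i : Fin m ⊕ Fin n,
    (((tau r i : ℤ) : F) * (-1 : F) ^ (idxPar i * μ.2.card)) •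
      ((mulO F (pd F i (X F μ))).comp (pd F (pr i)))

/-- The Hamiltonian map `D_H` as a linear map. -/
noncomputable def DH (r : ℕ) (pr : Fin m ⊕ Fin n → Fin m ⊕ Fin n) :
    O F m n →ₗ[F] Module.End F (O F m n) :=
  extend F (DHmono F r pr)

/-- Truncation condition `α ∈ A(m;t)`, i.e. `α_i ≤ π_i = p^{t_i} − 1`. -/
def inA (p : ℕ) (t : Fin m → ℕ) (α : Fin m → ℕ) : Prop := ∀ i, α i < p ^ t i

/-- The tuple `π`. -/
def piF (p : ℕ) (t : Fin m → ℕ) : Fin m → ℕ := fun i => p ^ t i - 1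

/-- The truncated algebra `O(m,n;t)` as a subspace. -/
noncomputable def Ot (p : ℕ) (t : Fin m → ℕ) : Submodule F (O F m n) :=
  Submodule.span F {x | ∃ μ : Mono m n, inA p t μ.1 ∧ x = X F μ}

/-- The even part `H₀̄` of the Hamiltonian superalgebra. -/
noncomputable def H0 (p r : ℕ) (t : Fin m → ℕ) (pr : Fin m ⊕ Fin n → Fin m ⊕ Fin n) :
    Submodule F (Module.End F (O F m n)) :=
  Submodule.span F {x | ∃ μ : Mono m n, inA p t μ.1 ∧ Even μ.2.card ∧
    ¬(μ.1 = piF p t ∧ μ.2 = Finset.univ) ∧ x = DHmono F r pr μ}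

/-- The codimension-one ideal `J` of `H₀̄`. -/
noncomputable def Jid (p r : ℕ) (t : Fin m → ℕ) (pr : Fin m ⊕ Fin n → Fin m ⊕ Fin n) :
    Submodule F (Module.End F (O F m n)) :=
  Submodule.span F {x | ∃ μ : Mono m n, inA p t μ.1 ∧ Even μ.2.card ∧
    ¬(μ.1 = piF p t ∧ μ.2 = Finset.univ) ∧ ¬(μ.1 = piF p t ∧ μ.2 = ∅) ∧
    x = DHmono F r pr μ}

/-- The odd part `W₁̄` of the Witt superalgebra `W(m,n;t)`. -/
noncomputable def W1 (p : ℕ) (t : Fin m → ℕ) : Submodule F (Module.End F (O F m n)) :=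
  Submodule.span F {x | ∃ (μ : Mono m n) (i : Fin m ⊕ Fin n), inA p t μ.1 ∧
    Odd (μ.2.card + idxPar i) ∧ x = fD F μ i}

/-- The `ℤ`-degree-`k` component of `W(m,n;t)`. -/
noncomputable def Wcomp (p : ℕ) (t : Fin m → ℕ) (k : ℤ) :
    Submodule F (Module.End F (O F m n)) :=
  Submodule.span F {x | ∃ (μ : Mono m n) (i : Fin m ⊕ Fin n), inA p t μ.1 ∧
    (((∑ l, μ.1 l : ℕ) : ℤ) + (μ.2.card : ℤ)) - 1 = k ∧ x = fD F μ i}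

/-- The iterated adjoint action `(ad D)^k (E)`. -/
noncomputable def adIter (D : Module.End F (O F m n)) (k : ℕ)
    (E : Module.End F (O F m n)) : Module.End F (O F m n) :=
  (fun E => D * E - E * D)^[k] E

end HamSup

namespace HamSup

variable (F : Type) [Field F] {m n : ℕ}

lemma extend_X {N : Type} [AddCommGroup N] [Module F N] (v : Mono m n → N) (μ : Mono m n) :
    extend F v (X F μ) = v μ := by
  simp [extend, X]

lemma end_ext {A B : Module.End F (O F m n)} (h : ∀ ν, A (X F ν) = B (X F ν)) : A = B := by
  apply Finsupp.lhom_ext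
  intro ν c
  have hc : (Finsupp.single ν c : O F m n) = c • X F ν := by simp [X]
  rw [hc, map_smul, map_smul, h]

/-- The Euler operator `x_j ∂_j`. -/
noncomputable def eul (j : Fin n) : Module.End F (O F m n) := fD F (0, {j}) (Sum.inr j)

lemma eul_X (j : Fin n) (ν : Mono m n) :
    eul F j (X F ν) = (if j ∈ ν.2 then (1 : F) else 0) • X F ν := by
  obtain ⟨α, u⟩ := ν
  simp only [eul, fD, pd, LinearMap.comp_apply, Sum.elim_inr, pdO, extend_X]
  split_ifs with h
  · simp only [mulO, map_smul, extend_X, mulMono]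
    rw [if_pos (by simp)]
    have h1 : invCount {j} (u.erase j) = (u.filter fun k => k < j).card := by
      unfold invCount
      apply Finset.card_bij (fun q _ => q.2)
      · rintro ⟨a, b⟩ hq
        simp only [Finset.mem_filter, Finset.mem_product, Finset.mem_singleton,
          Finset.mem_erase] at hq ⊢
        obtain ⟨⟨rfl, h1, h2⟩, h3⟩ := hq
        exact ⟨h2, h3⟩
      · rintro ⟨a, b⟩ hq ⟨a', b'⟩ hq' hab
        simp only [Finset.mem_filter, Finset.mem_product, Finset.mem_singleton] at hq hq' hab
        ext <;> simp [hq.1.1, hq'.1.1, hab]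
      · intro b hb
        simp only [Finset.mem_filter] at hb
        exact ⟨(j, b), by simp [hb.1, hb.2, hb.2.ne], rfl⟩
    have h2 : ({j} ∪ u.erase j : Finset (Fin n)) = u := by
      rw [← Finset.insert_eq, Finset.insert_erase h]
    simp only [h1, h2, zero_add, Pi.zero_apply, Nat.choose_zero_right, Nat.cast_one,
      Finset.prod_const_one, mul_one, smul_smul, one_smul]
    rw [← mul_pow]; simp
  · simp

/-- Weight of a set of odd variables. -/
def chi (k k' : Fin n) (u : Finset (Fin n)) : ℤ :=
  (if k' ∈ u then 1 else 0) - (if k ∈ u then 1 else 0)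

lemma chi_union (k k' : Fin n) {u v : Finset (Fin n)} (h : Disjoint u v) :
    chi k k' (u ∪ v) = chi k k' u + chi k k' v := by
  have h1 : ∀ a, a ∈ u → a ∉ v := fun a ha hv => (Finset.disjoint_left.mp h ha hv)
  have := h1 k
  have := h1 k'
  unfold chi
  simp only [Finset.mem_union]
  split_ifs <;> simp_all

lemma chi_erase (k k' j : Fin n) {u : Finset (Fin n)} (h : j ∈ u) :
    chi k k' (u.erase j) = chi k k' u - chi k k' {j} := by
  have h2 : ({j} ∪ u.erase j : Finset (Fin n)) = u := by
    rw [← Finset.insert_eq, Finset.insert_erase h]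
  have := chi_union k k' (u := {j}) (v := u.erase j) (by simp)
  rw [h2] at this
  omega

/-- Weight of a partial derivative index. -/
def wtI (k k' : Fin n) : Fin m ⊕ Fin n → ℤ := Sum.elim (fun _ => 0) (fun j => chi k k' {j})

/-- The torus element. -/
noncomputable def hk (k k' : Fin n) : Module.End F (O F m n) := eul F k' - eul F k

lemma hk_X (k k' : Fin n) (ν : Mono m n) :
    hk F k k' (X F ν) = ((chi k k' ν.2 : ℤ) : F) • X F ν := by
  simp only [hk, LinearMap.sub_apply, eul_X, chi, ← sub_smul]
  push_cast
  rfl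

lemma hk_mulMono (k k' : Fin n) (μ ν : Mono m n) :
    hk F k k' (mulMono F μ ν) = ((chi k k' μ.2 + chi k k' ν.2 : ℤ) : F) • mulMono F μ ν := by
  unfold mulMono
  split_ifs with h
  · rw [map_smul, hk_X, smul_comm, chi_union k k' h]
  · simp

lemma pd_X (i : Fin m ⊕ Fin n) (ν : Mono m n) :
    pd F i (X F ν) = 0 ∨ ∃ (c : F) (ρ : Mono m n), pd F i (X F ν) = c • X F ρ ∧
      ∀ k k', chi k k' ρ.2 = chi k k' ν.2 - wtI k k' i := by
  cases i with
  | inl i =>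
    simp only [pd, Sum.elim_inl, pdE, extend_X]
    split_ifs with h
    · exact Or.inl rfl
    · exact Or.inr ⟨1, _, (one_smul _ _).symm, by simp [wtI]⟩
  | inr j =>
    simp only [pd, Sum.elim_inr, pdO, extend_X]
    split_ifs with h
    · exact Or.inr ⟨_, _, rfl, fun k k' => by simp [wtI, chi_erase k k' j h]⟩
    · exact Or.inl rfl

lemma bracket_fD (k k' : Fin n) (μ : Mono m n) (i : Fin m ⊕ Fin n) :
    ⁅(hk F k k' : Module.End F (O F m n)), fD F μ i⁆ = ((chi k k' μ.2 - wtI k k' i : ℤ) : F) • fD F μ i := by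
  apply end_ext
  intro ν
  rw [Ring.lie_def]
  simp only [LinearMap.sub_apply, Module.End.mul_apply, LinearMap.smul_apply, hk_X, map_smul]
  simp only [fD, LinearMap.comp_apply]
  rcases pd_X F i ν with h | ⟨c, ρ, h, hρ⟩
  · simp [h]
  · rw [h]
    simp only [map_smul, mulO, extend_X, hk_mulMono, hρ]
    simp only [smul_smul, ← sub_smul]
    congr 1
    push_cast
    ring

/-- The polynomial with roots `±1, ±2`. -/
noncomputable def qT {V : Type} [AddCommMonoid V] [Module F V] (T : Module.End F V) : Module.End F V :=
  T * T * (T * T) + (-5 : F) • (T * T) + (4 : F) • 1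

lemma qT_eig {V : Type} [AddCommMonoid V] [Module F V] (T : Module.End F V) (g : V) (c : F)
    (h : T g = c • g) : qT F T g = (c ^ 4 - 5 * c ^ 2 + 4) • g := by
  simp only [qT, LinearMap.add_apply, LinearMap.sub_apply, Module.End.mul_apply,
    LinearMap.smul_apply, h, map_smul, Module.End.one_apply]
  module

lemma prod_eig {V : Type} [AddCommMonoid V] [Module F V] {ι : Type}
    (T : ι → Module.End F V) (g : V) (c : ι → F) (h : ∀ a, T a g = c a • g) (l : List ι) :
    (l.map fun a => qT F (T a)).prod g =
      (l.map fun a => (c a ^ 4 - 5 * c a ^ 2 + 4)).prod • g := by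
  induction l with
  | nil => simp
  | cons a l ih =>
    simp only [List.map_cons, List.prod_cons, Module.End.mul_apply, ih, map_smul,
      qT_eig F (T a) g (c a) (h a), smul_smul]
    congr 1
    ring

/-- The adjoint action as a linear map. -/
noncomputable def adT (h : Module.End F (O F m n)) :
    Module.End F (O F m n) →ₗ[F] Module.End F (O F m n) where
  toFun g := ⁅h, g⁆
  map_add' x y := by
    rw [Ring.lie_def, Ring.lie_def, Ring.lie_def]
    apply LinearMap.ext
    intro v
    simp only [LinearMap.sub_apply, LinearMap.add_apply, Module.End.mul_apply, map_add]
    abel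
  map_smul' c x := by
    rw [Ring.lie_def, Ring.lie_def]
    apply LinearMap.ext
    intro v
    simp only [LinearMap.sub_apply, LinearMap.smul_apply, Module.End.mul_apply, map_smul,
      RingHom.id_apply, smul_sub]

lemma adT_apply (h g : Module.End F (O F m n)) : adT F h g = ⁅h, g⁆ := rfl

lemma zero_br (g : Module.End F (O F m n)) : ⁅(0 : Module.End F (O F m n)), g⁆ = 0 := by
  rw [Ring.lie_def]
  apply LinearMap.ext
  intro v
  simp

lemma neg_br (h g : Module.End F (O F m n)) (hz : ⁅h, g⁆ = 0) : ⁅-h, g⁆ = 0 := by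
  rw [Ring.lie_def] at hz ⊢
  apply LinearMap.ext
  intro v
  have := LinearMap.congr_fun hz v
  simp only [LinearMap.sub_apply, LinearMap.neg_apply, Module.End.mul_apply, map_neg,
    LinearMap.zero_apply] at this ⊢
  rw [← neg_sub', this, neg_zero]

lemma exists_odd_weight (pr : Fin n → Fin n) (h1 : ∀ j, pr (pr j) = j) (h2 : ∀ j, pr j ≠ j)
    (μ : Mono m n) (i : Fin m ⊕ Fin n) (ho : Odd (μ.2.card + idxPar i)) :
    ∃ k, chi k (pr k) μ.2 - wtI k (pr k) i ≠ 0 := by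
  by_contra! hc
  have key : ∑ a : Fin n, ((if a ∈ μ.2 then (1 : ZMod 2) else 0) +
      Sum.elim (fun _ => 0) (fun j => if a = j then 1 else 0) i) = 0 := by
    apply Finset.sum_involution (fun a _ => pr a)
    · intro a _
      have := congrArg (Int.cast : ℤ → ZMod 2) (hc a)
      cases i with
      | inl i =>
        simp only [chi, wtI, Sum.elim_inl] at this ⊢
        revert this
        split_ifs <;> simp <;> decide
      | inr j =>
        simp only [chi, wtI, Sum.elim_inr, Finset.mem_singleton] at this ⊢
        revert this
        split_ifs <;> simp <;> decide
    · intro a _ _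
      exact h2 a
    · intro a _
      exact Finset.mem_univ _
    · intro a _
      exact h1 a
  have hz : ((μ.2.card + idxPar i : ℕ) : ZMod 2) = 0 := by
    rw [← key, Finset.sum_add_distrib]
    cases i <;> simp [idxPar]
  rw [ZMod.natCast_eq_zero_iff] at hz
  exact (Nat.not_even_iff_odd.mpr ho) (even_iff_two_dvd.mpr hz)

lemma centralizer_zero (p : ℕ) (t : Fin m → ℕ) (h2F : (2 : F) ≠ 0)
    (pr : Fin n → Fin n) (h1 : ∀ j, pr (pr j) = j) (h2 : ∀ j, pr j ≠ j)
    (w : Module.End F (O F m n)) (hw : w ∈ W1 F p t)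
    (hc : ∀ k, ⁅(hk F k (pr k) : Module.End F (O F m n)), w⁆ = 0) : w = 0 := by
  let T : Fin n → Module.End F (Module.End F (O F m n)) := fun k =>
    adT F (hk F k (pr k))
  have hT : ∀ k g, T k g = ⁅(hk F k (pr k) : Module.End F (O F m n)), g⁆ := fun k g => adT_apply F _ _
  let P := ((Finset.univ : Finset (Fin n)).toList.map fun a => qT F (T a)).prod
  have hP : ∀ x ∈ W1 F p t, P x = 0 := by
    intro x hx
    induction hx using Submodule.span_induction with
    | mem x hx =>
      obtain ⟨μ, i, _, ho, rfl⟩ := hx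
      have := prod_eig F T (fD F μ i)
        (fun k => ((chi k (pr k) μ.2 - wtI k (pr k) i : ℤ) : F))
        (fun k => by rw [hT, bracket_fD]) (Finset.univ : Finset (Fin n)).toList
      rw [show P (fD F μ i) = _ from this]
      obtain ⟨k, hk0⟩ := exists_odd_weight pr h1 h2 μ i ho
      rw [List.prod_eq_zero, zero_smul]
      rw [List.mem_map]
      refine ⟨k, by simp, ?_⟩
      have hb : ∀ u : Finset (Fin n), chi k (pr k) u = -1 ∨ chi k (pr k) u = 0 ∨
          chi k (pr k) u = 1 := by
        intro u; unfold chi; split_ifs <;> simp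
      have hb' : wtI k (pr k) i = -1 ∨ wtI k (pr k) i = 0 ∨ wtI k (pr k) i = 1 := by
        cases i with
        | inl i => simp [wtI]
        | inr j => exact hb {j}
      rcases hb μ.2 with h | h | h <;> rcases hb' with h' | h' | h' <;> rw [h, h'] at hk0 ⊢ <;>
        first
          | exact absurd rfl hk0
          | (push_cast; ring)
    | zero => simp
    | add x y _ _ hx hy => rw [map_add, hx, hy, add_zero]
    | smul a x _ hx => rw [map_smul, hx, smul_zero]
  have h0 := prod_eig F T w (fun _ => 0) (fun k => by rw [hT, hc, zero_smul])
    (Finset.univ : Finset (Fin n)).toList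
  rw [show _ = _ from hP w hw] at h0
  have h4 : (4 : F) ≠ 0 := by
    have : (4 : F) = 2 * 2 := by norm_num
    rw [this]; exact mul_ne_zero h2F h2F
  rcases smul_eq_zero.mp h0.symm with h | h
  · exfalso
    revert h
    rw [imp_false]
    apply List.prod_ne_zero
    simp [h4.symm]
  · exact h

lemma hk_swap (k k' : Fin n) : (hk F k' k : Module.End F (O F m n)) = - hk F k k' := by
  apply LinearMap.ext
  intro v
  simp [hk]

lemma DHmono_torus (r : ℕ) (prE : Fin m → Fin m) (pr : Fin n → Fin n)
    (h1 : ∀ j, pr (pr j) = j) (k : Fin n) (hlt : k < pr k) :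
    DHmono F r (Sum.map prE pr) ((0, {k, pr k}) : Mono m n) = hk F k (pr k) := by
  unfold DHmono
  rw [Fintype.sum_sum_type]
  have hc : ({k, pr k} : Finset (Fin n)).card = 2 := Finset.card_pair hlt.ne
  have hz : ∀ i : Fin m, pd F (Sum.inl i) (X F ((0, {k, pr k}) : Mono m n)) = 0 := by
    intro i; simp [pd, pdE, extend_X]
  simp only [hz, map_zero, LinearMap.zero_comp, smul_zero, Finset.sum_const_zero, zero_add]
  have hs : ∀ j : Fin n, j ≠ k → j ≠ pr k →
      pd F (Sum.inr j) (X F ((0, {k, pr k}) : Mono m n)) = 0 := by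
    intro j ha hb; simp [pd, pdO, extend_X, ha, hb]
  rw [← Finset.sum_subset (Finset.subset_univ {k, pr k})
    (fun j _ hj => by
      simp only [Finset.mem_insert, Finset.mem_singleton, not_or] at hj
      rw [hs j hj.1 hj.2]; simp)]
  rw [Finset.sum_pair hlt.ne]
  have e1 : pd F (Sum.inr k) (X F ((0, {k, pr k}) : Mono m n)) = X F (0, {pr k}) := by
    have f1 : (({k, pr k} : Finset (Fin n)).filter fun a => a < k) = ∅ := by
      ext a; simp only [Finset.mem_filter, Finset.mem_insert, Finset.mem_singleton,
        Finset.notMem_empty, iff_false, not_and]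
      rintro (rfl | rfl)
      · exact lt_irrefl _
      · exact hlt.asymm
    have f2 : ({k, pr k} : Finset (Fin n)).erase k = {pr k} := by
      ext a; simp only [Finset.mem_erase, Finset.mem_insert, Finset.mem_singleton]
      have := hlt.ne
      grind
    simp only [pd, Sum.elim_inr, pdO, extend_X]
    rw [if_pos (by simp), f1, f2]; simp
  have e2 : pd F (Sum.inr (pr k)) (X F ((0, {k, pr k}) : Mono m n)) = - X F (0, {k}) := by
    have f1 : (({k, pr k} : Finset (Fin n)).filter fun a => a < pr k) = {k} := by
      ext a; simp only [Finset.mem_filter, Finset.mem_insert, Finset.mem_singleton]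
      constructor
      · rintro ⟨rfl | rfl, h⟩
        · rfl
        · exact absurd h (lt_irrefl _)
      · rintro rfl; exact ⟨Or.inl rfl, hlt⟩
    have f2 : ({k, pr k} : Finset (Fin n)).erase (pr k) = {k} := by
      ext a; simp only [Finset.mem_erase, Finset.mem_insert, Finset.mem_singleton]
      have := hlt.ne
      grind
    simp only [pd, Sum.elim_inr, pdO, extend_X]
    rw [if_pos (by simp), f1, f2]; simp
  rw [e1, e2]
  simp only [hc, tau, idxPar, Sum.elim_inr, Sum.map_inr, h1, hk, eul, fD]
  apply LinearMap.ext
  intro x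
  simp [sub_eq_add_neg]

lemma bracket_top (r : ℕ) (pr : Fin m ⊕ Fin n → Fin m ⊕ Fin n) (prE : Fin m → Fin m)
    (hpr : ∀ i, pr (Sum.inl i) = Sum.inl (prE i)) (k k' : Fin n) (α : Fin m → ℕ) :
    ⁅(hk F k k' : Module.End F (O F m n)), DHmono F r pr ((α, ∅) : Mono m n)⁆ = 0 := by
  unfold DHmono
  rw [← adT_apply, map_sum]
  apply Finset.sum_eq_zero
  intro i _
  rw [map_smul]
  cases i with
  | inr j => simp [pd, pdO, extend_X]
  | inl i =>
    rw [hpr]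
    simp only [pd, Sum.elim_inl, pdE, extend_X]
    split_ifs with h
    · simp
    · have := bracket_fD F k k' ((Function.update α i (α i - 1), ∅) : Mono m n)
        (Sum.inl (prE i))
      simp only [fD, pd, Sum.elim_inl, wtI, chi] at this
      simp only [pdE] at this
      rw [adT_apply, this]; simp

lemma DHmono_zero_of_m (r : ℕ) (pr : Fin m ⊕ Fin n → Fin m ⊕ Fin n) (h : m = 0)
    (α : Fin m → ℕ) : DHmono F r pr ((α, ∅) : Mono m n) = 0 := by
  unfold DHmono
  apply Finset.sum_eq_zero
  intro i _
  cases i with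
  | inr j => simp [pd, pdO, extend_X]
  | inl i => subst h; exact i.elim0

end HamSup

open HamSup in
/-- for `n` even, every derivation `H₀̄ → W₁̄` vanishing on `J` is zero. -/
theorem deriv_vanishing_J_even (F : Type) [Field F] (m n p : ℕ) (hp : p.Prime) (h3 : 3 < p)
    (hchar : ringChar F = p) (r s : ℕ) (hm : m = 2 * r) (hn : n = 2 * s)
    (t : Fin m → ℕ) (ht : ∀ i, 0 < t i)
    (prE : Fin m → Fin m)
    (hprE : ∀ i : Fin m, (prE i : ℕ) = if (i : ℕ) < r then (i : ℕ) + r else (i : ℕ) - r)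
    (prO : Fin n → Fin n)
    (hprO : ∀ j : Fin n, (prO j : ℕ) =
      if (j : ℕ) < s then (j : ℕ) + s else if (j : ℕ) < 2 * s then (j : ℕ) - s else (j : ℕ)) :
    ∀ φ : Module.End F (O F m n) →ₗ[F] Module.End F (O F m n),
      (∀ x, x ∈ H0 F p r t (Sum.map prE prO) → φ x ∈ W1 F p t) →
      (∀ x, x ∈ H0 F p r t (Sum.map prE prO) → ∀ y, y ∈ H0 F p r t (Sum.map prE prO) →
      φ ⁅x, y⁆ = ⁅φ x, y⁆ + ⁅x, φ y⁆) →
      (∀ x, x ∈ Jid F p r t (Sum.map prE prO) → φ x = 0) →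
      ∀ x, x ∈ H0 F p r t (Sum.map prE prO) → φ x = 0 := by
  intro φ hφW hder hJ x hx
  have h1 : ∀ j, prO (prO j) = j := by
    intro j
    apply Fin.ext
    have := j.isLt
    rw [hprO, hprO]
    split_ifs <;> omega
  have h2 : ∀ j, prO j ≠ j := by
    intro j h
    have h' := congrArg Fin.val h
    have := j.isLt
    rw [hprO] at h'
    split_ifs at h' <;> omega
  have h2F : (2 : F) ≠ 0 := by
    intro h
    have h' : ((2 : ℕ) : F) = 0 := by exact_mod_cast h
    rw [ringChar.spec, hchar] at h'
    have := Nat.le_of_dvd (by norm_num) h'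
    omega
  induction hx using Submodule.span_induction with
  | zero => simp
  | add x y _ _ hx hy => rw [map_add, hx, hy, add_zero]
  | smul a x _ hx => rw [map_smul, hx, smul_zero]
  | mem x hx =>
    obtain ⟨μ, hA, hE, hne, rfl⟩ := hx
    by_cases hμ : μ.1 = piF p t ∧ μ.2 = ∅
    swap
    · exact hJ _ (Submodule.subset_span ⟨μ, hA, hE, hne, hμ, rfl⟩)
    have hxH : DHmono F r (Sum.map prE prO) μ ∈ H0 F p r t (Sum.map prE prO) :=
      Submodule.subset_span ⟨μ, hA, hE, hne, rfl⟩
    obtain ⟨α, u⟩ := μ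
    obtain ⟨rfl, rfl⟩ : α = piF p t ∧ u = ∅ := hμ
    by_cases hm0 : m = 0
    · rw [DHmono_zero_of_m F r _ hm0, map_zero]
    have hpi : ∀ i, 0 < piF p t i := by
      intro i
      have : 1 < p ^ t i := Nat.one_lt_pow (ht i).ne' hp.one_lt
      unfold piF; omega
    have h0pi : (0 : Fin m → ℕ) ≠ piF p t := by
      intro h
      have := hpi ⟨0, Nat.pos_of_ne_zero hm0⟩
      rw [← h] at this
      exact lt_irrefl _ this
    apply centralizer_zero F p t h2F prO h1 h2 _ (hφW _ hxH)
    have main : ∀ k, k < prO k →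
        ⁅(hk F k (prO k) : Module.End F (O F m n)), φ (DHmono F r (Sum.map prE prO) (piF p t, ∅))⁆ = 0 := by
      intro k hlt
      have hA0 : inA p t (0 : Fin m → ℕ) := fun i => pow_pos hp.pos _
      have hc : Even ({k, prO k} : Finset (Fin n)).card := by
        rw [Finset.card_pair hlt.ne]; exact even_two
      have hkJ : hk F k (prO k) ∈ Jid F p r t (Sum.map prE prO) :=
        Submodule.subset_span ⟨(0, {k, prO k}), hA0, hc, fun h => h0pi h.1, fun h => h0pi h.1,
          (DHmono_torus F r prE prO h1 k hlt).symm⟩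
      have hkH : hk F k (prO k) ∈ H0 F p r t (Sum.map prE prO) :=
        Submodule.subset_span ⟨(0, {k, prO k}), hA0, hc, fun h => h0pi h.1,
          (DHmono_torus F r prE prO h1 k hlt).symm⟩
      have hd := hder _ hkH _ hxH
      rw [bracket_top F r _ prE (fun i => rfl), map_zero, hJ _ hkJ, zero_br] at hd
      apply LinearMap.ext
      intro v
      have := LinearMap.congr_fun hd v
      simpa using this.symm
    intro k
    rcases lt_or_gt_of_ne (h2 k) with h | h
    · have := main (prO k) (by rw [h1]; exact h)
      rw [h1] at this
      rw [hk_swap]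
      exact neg_br F _ _ this
    · exact main k h
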